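/- Pointwise diagonalization of the MIT bag boundary condition: for every unit vector n ∈ ℝ³ the matrix P_n = (1/√2)·!![1₂, i(σ·n); i(σ·n), 1₂] is unitary and satisfies P_n⁻¹·𝓑(n)·P_n = β. -/

import Mathlib

open Matrix Complex

noncomputable section

/-- The Pauli matrices. -/
def σ : Fin 3 → Matrix (Fin 2) (Fin 2) ℂ :=
  ![!![0, 1; 1, 0], !![0, -Complex.I; Complex.I, 0], !![1, 0; 0, -1]]

/-- Assemble a 4×4 matrix from four 2×2 blocks. -/
def blk (A B C D : Matrix (Fin 2) (Fin 2) ℂ) : Matrix (Fin 4) (Fin 4) ℂ :=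
  Matrix.reindex finSumFinEquiv finSumFinEquiv (Matrix.fromBlocks A B C D)

/-- The Dirac matrix β. -/
def diracβ : Matrix (Fin 4) (Fin 4) ℂ := blk 1 0 0 (-1)

/-- The Dirac matrix γ₅. -/
def diracγ5 : Matrix (Fin 4) (Fin 4) ℂ := blk 0 1 1 0

/-- The Dirac matrices α₁, α₂, α₃ (indexed by `Fin 3`). -/
def diracα (k : Fin 3) : Matrix (Fin 4) (Fin 4) ℂ := blk 0 (σ k) (σ k) 0

/-- For `x ∈ ℝ³`, the matrix `α · x = x₁ α₁ + x₂ α₂ + x₃ α₃`. -/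
def αdot (x : Fin 3 → ℝ) : Matrix (Fin 4) (Fin 4) ℂ := ∑ k, (x k : ℂ) • diracα k

/-- The MIT bag boundary matrix `𝓑(n) = -iβ(α·n)`. -/
def mitB (n : Fin 3 → ℝ) : Matrix (Fin 4) (Fin 4) ℂ := -Complex.I • (diracβ * αdot n)

/-- For `x ∈ ℝ³`, the matrix `σ · x = x₁ σ₁ + x₂ σ₂ + x₃ σ₃`. -/
def σdot (x : Fin 3 → ℝ) : Matrix (Fin 2) (Fin 2) ℂ := ∑ k, (x k : ℂ) • σ k

/-- The matrix `P_n = (1/√2)·!![1₂, i(σ·n); i(σ·n), 1₂]`. -/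
def Pmat (n : Fin 3 → ℝ) : Matrix (Fin 4) (Fin 4) ℂ :=
  ((Real.sqrt 2 : ℂ))⁻¹ • blk 1 (Complex.I • σdot n) (Complex.I • σdot n) 1

theorem σdot_conjTranspose (x : Fin 3 → ℝ) : (σdot x)ᴴ = σdot x := by
  ext i j
  fin_cases i <;> fin_cases j <;> simp [σdot, σ, Fin.sum_univ_three]

theorem σdot_mul_self (x : Fin 3 → ℝ) :
    σdot x * σdot x = ((∑ i, x i ^ 2 : ℝ) : ℂ) • (1 : Matrix (Fin 2) (Fin 2) ℂ) := by
  ext i j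
  fin_cases i <;> fin_cases j <;>
    simp [σdot, σ, Fin.sum_univ_three, Matrix.mul_apply] <;> ring_nf <;> simp

theorem blk_mul (A B C D A' B' C' D' : Matrix (Fin 2) (Fin 2) ℂ) :
    blk A B C D * blk A' B' C' D' =
      blk (A * A' + B * C') (A * B' + B * D') (C * A' + D * C') (C * B' + D * D') := by
  simp only [blk, Matrix.reindex_apply, Matrix.submatrix_mul_equiv, Matrix.fromBlocks_multiply]

theorem blk_conjTranspose (A B C D : Matrix (Fin 2) (Fin 2) ℂ) :
    (blk A B C D)ᴴ = blk Aᴴ Cᴴ Bᴴ Dᴴ := by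
  simp only [blk, Matrix.reindex_apply, Matrix.conjTranspose_submatrix,
    Matrix.fromBlocks_conjTranspose]

theorem smul_blk (c : ℂ) (A B C D : Matrix (Fin 2) (Fin 2) ℂ) :
    c • blk A B C D = blk (c • A) (c • B) (c • C) (c • D) := by
  simp only [blk, Matrix.reindex_apply, ← Matrix.fromBlocks_smul, Matrix.submatrix_smul,
    Pi.smul_apply]

theorem blk_add (A B C D A' B' C' D' : Matrix (Fin 2) (Fin 2) ℂ) :
    blk A B C D + blk A' B' C' D' = blk (A + A') (B + B') (C + C') (D + D') := by
  simp only [blk, Matrix.reindex_apply, ← Matrix.fromBlocks_add, Matrix.submatrix_add,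
    Pi.add_apply]

theorem blk_one : blk 1 0 0 1 = 1 := by
  simp [blk, Matrix.fromBlocks_one]

theorem αdot_eq_blk (x : Fin 3 → ℝ) : αdot x = blk 0 (σdot x) (σdot x) 0 := by
  simp only [αdot, σdot, diracα, Fin.sum_univ_three, smul_blk, blk_add, smul_zero, add_zero]

theorem mitB_eq_blk (x : Fin 3 → ℝ) :
    mitB x = blk 0 (-Complex.I • σdot x) (Complex.I • σdot x) 0 := by
  rw [mitB, diracβ, αdot_eq_blk, blk_mul, smul_blk]
  simp

theorem inv_sqrt_two_mul_self : ((Real.sqrt 2 : ℂ))⁻¹ * ((Real.sqrt 2 : ℂ))⁻¹ = 2⁻¹ := by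
  rw [← mul_inv, ← Complex.ofReal_mul, Real.mul_self_sqrt (by norm_num)]
  norm_num

theorem Pmat_conjTranspose (x : Fin 3 → ℝ) :
    (Pmat x)ᴴ =
      ((Real.sqrt 2 : ℂ))⁻¹ • blk 1 (-Complex.I • σdot x) (-Complex.I • σdot x) 1 := by
  simp [Pmat, Matrix.conjTranspose_smul, blk_conjTranspose, σdot_conjTranspose]

theorem Pmat_mul_conjTranspose {n : Fin 3 → ℝ} (hn : ∑ i, n i ^ 2 = 1) :
    Pmat n * (Pmat n)ᴴ = 1 := by
  have hS : σdot n * σdot n = 1 := by rw [σdot_mul_self, hn]; simp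
  rw [Pmat_conjTranspose, Pmat, smul_mul_smul_comm, inv_sqrt_two_mul_self, blk_mul, ← blk_one,
    smul_blk]
  congr 1 <;> simp [smul_smul, hS] <;> module

theorem mitB_mul_Pmat {n : Fin 3 → ℝ} (hn : ∑ i, n i ^ 2 = 1) :
    mitB n * Pmat n = Pmat n * diracβ := by
  have hS : σdot n * σdot n = 1 := by rw [σdot_mul_self, hn]; simp
  rw [mitB_eq_blk, Pmat, diracβ, mul_smul_comm, smul_mul_assoc, blk_mul, blk_mul]
  simp [smul_smul, hS]

/-- Pointwise diagonalization of the MIT bag boundary condition: for every unit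
vector `n`, `P_n` is unitary and `P_n⁻¹ 𝓑(n) P_n = β`. -/
theorem mitB_diagonalization (n : Fin 3 → ℝ) (hn : ∑ i, n i ^ 2 = 1) :
    Pmat n * (Pmat n)ᴴ = 1 ∧ (Pmat n)ᴴ * Pmat n = 1 ∧
    (Pmat n)⁻¹ * mitB n * Pmat n = diracβ := by
  have h₁ := Pmat_mul_conjTranspose hn
  have h₂ : (Pmat n)ᴴ * Pmat n = 1 := mul_eq_one_comm.mp h₁
  refine ⟨h₁, h₂, ?_⟩
  rw [Matrix.inv_eq_left_inv h₂, mul_assoc, mitB_mul_Pmat hn, ← mul_assoc, h₂, one_mul]
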